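/- Let q : ℝ → ℝ be continuous with ∫_a^∞ (1 + t²)·|q(t)| dt < ∞ for every a ∈ ℝ and set Q(x) = ∫_{x/2}^∞ |q(t)| dt. Let K : {(x,y) : y ≥ x} → ℝ be continuously differentiable with |K(x,y)| ≤ C(x)·Q(x+y) and |∂K/∂x (x,y)| + |∂K/∂y (x,y)| ≤ C(x)·( |q((x+y)/2)| + Q(x+y) ) for some positive continuous nonincreasing C. Let F : ℝ² → ℝ be symmetric (F(x,y) = F(y,x)) with continuous first-order partial derivatives, satisfy |F(x,y)| ≤ C₁(x)·Q(x+y) for y ≥ x with C₁ positive continuous nonincreasing, and satisfy the GLM equation K(x,y) + F(x,y) + ∫_x^∞ K(x,t)·F(t,y) dt = 0 for all y ≥ x. Then there exists a positive continuous nonincreasing function Ĉ : ℝ → ℝ such that |∂F/∂x (x,y)| + |∂F/∂y (x,y)| ≤ Ĉ(x)·( |q((x+y)/2)| + Q(x+y) ) for all y ≥ x. -/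

import Mathlib

open MeasureTheory Filter

/-- `Q(x) = ∫_{x/2}^∞ |q(t)| dt`. -/
noncomputable def Qfun (q : ℝ → ℝ) (x : ℝ) : ℝ := ∫ t in Set.Ioi (x / 2), |q t|

open Set Topology intervalIntegral

section TailIntegrals

variable {f : ℝ → ℝ}

lemma integrableOn_Ioi_comp_add (hf : ∀ a, IntegrableOn f (Ioi a)) (s a : ℝ) :
    IntegrableOn (fun t => f (s + t)) (Ioi a) := by
  have h := (measurePreserving_add_left volume s).integrableOn_comp_preimage
    (MeasurableEquiv.addLeft s).measurableEmbedding (f := f) (s := Ioi (s + a))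
  have := h.2 (hf (s + a))
  simpa [Function.comp_def] using this

lemma integral_Ioi_comp_add (f : ℝ → ℝ) (s a : ℝ) :
    ∫ t in Ioi a, f (s + t) = ∫ t in Ioi (s + a), f t := by
  have h := (measurePreserving_add_left volume s).setIntegral_preimage_emb
    (MeasurableEquiv.addLeft s).measurableEmbedding f (Ioi (s + a))
  simpa using h

lemma antitone_integral_Ioi (hf : ∀ a, IntegrableOn f (Ioi a)) (h0 : ∀ x, 0 ≤ f x) :
    Antitone fun a => ∫ t in Ioi a, f t := fun a _ hab =>
  setIntegral_mono_set (hf a) (Eventually.of_forall h0) (Ioi_subset_Ioi hab).eventuallyLE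

lemma continuous_integral_Ioi (hf : ∀ a, IntegrableOn f (Ioi a)) :
    Continuous fun a => ∫ t in Ioi a, f t := by
  rw [continuous_iff_continuousAt]
  intro x
  exact (hf (x - 1)).continuousOn_Ici_primitive_Ioi.continuousAt (Ici_mem_nhds (by linarith))

lemma intervalIntegral_le_integral_Ioi (hf : ∀ a, IntegrableOn f (Ioi a)) (h0 : ∀ x, 0 ≤ f x)
    {a b : ℝ} (hab : a ≤ b) : ∫ t in a..b, f t ≤ ∫ t in Ioi a, f t := by
  rw [integral_of_le hab]
  exact setIntegral_mono_set (hf a) (Eventually.of_forall h0) Ioc_subset_Ioi_self.eventuallyLE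

/-- Tonelli bound for the tail integral of the increments of a primitive. -/
lemma integral_Ioi_intervalIntegral_comp_add_le (hc : Continuous f)
    (hf : ∀ a, IntegrableOn f (Ioi a)) (h0 : ∀ x, 0 ≤ f x) {a b : ℝ} (hab : a ≤ b) (c : ℝ) :
    IntegrableOn (fun t => ∫ s in a..b, f (s + t)) (Ioi c) ∧
      ∫ t in Ioi c, ∫ s in a..b, f (s + t) ≤ (b - a) * ∫ t in Ioi (a + c), f t := by
  have hcont := continuous_integral_Ioi hf
  have hint : Integrable (Function.uncurry fun s t => f (s + t))
      ((volume.restrict (Ioc a b)).prod (volume.restrict (Ioi c))) := by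
    refine (integrable_prod_iff (by
      apply Continuous.aestronglyMeasurable
      unfold Function.uncurry
      fun_prop)).2 ⟨Eventually.of_forall fun s => integrableOn_Ioi_comp_add hf s c, ?_⟩
    have : (fun s => ∫ t in Ioi c, ‖Function.uncurry (fun s t => f (s + t)) (s, t)‖)
        = fun s => ∫ t in Ioi (s + c), f t := by
      funext s
      rw [← integral_Ioi_comp_add]
      simp [Function.uncurry, abs_of_nonneg (h0 _)]
    rw [this]
    exact ((hcont.comp (continuous_add_const c)).integrableOn_Icc (a := a) (b := b)).mono_set
      Ioc_subset_Icc_self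
  simp only [integral_of_le hab]
  refine ⟨hint.integral_prod_right, ?_⟩
  rw [← integral_integral_swap hint]
  simp only [integral_Ioi_comp_add]
  have hconst : (b - a) * ∫ t in Ioi (a + c), f t
      = ∫ _ in Ioc a b, ∫ t in Ioi (a + c), f t := by
    simp [hab]
  rw [hconst]
  refine setIntegral_mono_on ?_ (by simp) measurableSet_Ioc fun s hs =>
    antitone_integral_Ioi hf h0 (by linarith [hs.1])
  exact ((hcont.comp (continuous_add_const c)).integrableOn_Icc (a := a) (b := b)).mono_set
      Ioc_subset_Icc_self

end TailIntegrals

lemma abs_sub_le_integral_of_hasDerivAt {f f' φ : ℝ → ℝ} {a b : ℝ} (hab : a ≤ b)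
    (hcont : ContinuousOn f (Icc a b)) (hderiv : ∀ x ∈ Ioo a b, HasDerivAt f (f' x) x)
    (hφ : Continuous φ) (hbd : ∀ x ∈ Ioo a b, |f' x| ≤ φ x) :
    |f b - f a| ≤ ∫ x in a..b, φ x := by
  rw [abs_le']
  constructor
  · exact sub_le_integral_of_hasDeriv_right_of_le hab hcont
      (fun x hx => (hderiv x hx).hasDerivWithinAt) hφ.integrableOn_Icc
      fun x hx => (le_abs_self _).trans (hbd x hx)
  · have := sub_le_integral_of_hasDeriv_right_of_le hab hcont.fun_neg
      (fun x hx => (hderiv x hx).fun_neg.hasDerivWithinAt) hφ.integrableOn_Icc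
      fun x hx => (neg_le_abs _).trans (hbd x hx)
    linarith

lemma HasDerivWithinAt.abs_le_of_forall_abs_sub_le {f : ℝ → ℝ} {f' a b N : ℝ}
    (hf : HasDerivWithinAt f f' (Ici a) a) (hab : a < b)
    (hbd : ∀ x ∈ Ioo a b, |f x - f a| ≤ (x - a) * N) : |f'| ≤ N := by
  have h := (hasDerivWithinAt_iff_tendsto_slope' self_notMem_Ioi).1 hf.Ioi_of_Ici
  refine le_of_tendsto h.abs ?_
  filter_upwards [Ioo_mem_nhdsGT hab] with x hx
  have hx0 : 0 < x - a := sub_pos.2 hx.1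
  rw [slope_def_field, abs_div, abs_of_pos hx0, div_le_iff₀ hx0, mul_comm]
  exact hbd x hx

/-- Backward Grönwall inequality with a nonconstant inhomogeneity. -/
lemma gronwall_backward {φ k α : ℝ → ℝ} (hφ : Continuous φ) (hk : Continuous k)
    (hα : Continuous α) (hk0 : ∀ x, 0 ≤ k x) (hα0 : ∀ x, 0 ≤ α x) {a b : ℝ} (hab : a ≤ b)
    (h : ∀ x ∈ Icc a b, φ x ≤ α x + ∫ t in x..b, k t * φ t) :
    φ a ≤ α a + Real.exp (∫ t in a..b, k t) * ∫ t in a..b, k t * α t := by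
  have hkφ : Continuous fun t => k t * φ t := hk.mul hφ
  set P : ℝ → ℝ := fun x => ∫ t in a..x, k t with hP
  have hPd : ∀ x, HasDerivAt P (k x) x := fun x =>
    integral_hasDerivAt_right (hk.intervalIntegrable _ _)
      (hk.stronglyMeasurableAtFilter _ _) hk.continuousAt
  have hψd : ∀ x, HasDerivAt (fun x => ∫ t in x..b, k t * φ t) (-(k x * φ x)) x := fun x =>
    integral_hasDerivAt_left (hkφ.intervalIntegrable _ _)
      (hkφ.stronglyMeasurableAtFilter _ _) hkφ.continuousAt
  have hd : ∀ x, HasDerivAt (fun x => -((∫ t in x..b, k t * φ t) * Real.exp (P x)))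
      (-(-(k x * φ x) * Real.exp (P x) +
        (∫ t in x..b, k t * φ t) * (Real.exp (P x) * k x))) x := fun x =>
    ((hψd x).mul (hPd x).exp).fun_neg
  have key := sub_le_integral_of_hasDeriv_right_of_le hab
    (fun x _ => (hd x).continuousAt.continuousWithinAt) (fun x _ => (hd x).hasDerivWithinAt)
    (φ := fun x => Real.exp (P b) * (k x * α x))
    (Continuous.integrableOn_Icc (by fun_prop)) (by
      intro x hx
      have h1 := h x ⟨hx.1.le, hx.2.le⟩
      have hPx : P x ≤ P b := by
        have hadd : P x + ∫ t in x..b, k t = P b :=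
          integral_add_adjacent_intervals (hk.intervalIntegrable _ _) (hk.intervalIntegrable _ _)
        have := integral_nonneg (μ := volume) hx.2.le fun u _ => hk0 u
        linarith
      have h2 : Real.exp (P x) * (k x * α x) ≤ Real.exp (P b) * (k x * α x) :=
        mul_le_mul_of_nonneg_right (Real.exp_le_exp.2 hPx) (mul_nonneg (hk0 x) (hα0 x))
      have h3 := mul_le_mul_of_nonneg_left h1 (mul_nonneg (Real.exp_pos (P x)).le (hk0 x))
      linarith)
  have hPa : P a = 0 := integral_same
  rw [intervalIntegral.integral_const_mul] at key
  simp only [integral_same, hPa, Real.exp_zero] at key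
  have := h a ⟨le_rfl, hab⟩
  linarith

section Majorant

variable {q : ℝ → ℝ}

lemma integrableOn_abs_of_moment (hq : Continuous q)
    (hmom : ∀ a : ℝ, IntegrableOn (fun t => (1 + t ^ 2) * |q t|) (Ioi a)) (a : ℝ) :
    IntegrableOn (fun t => |q t|) (Ioi a) := by
  refine (hmom a).mono' hq.abs.aestronglyMeasurable (Eventually.of_forall fun t => ?_)
  rw [Real.norm_eq_abs, abs_abs]
  nlinarith [mul_nonneg (sq_nonneg t) (abs_nonneg (q t))]

lemma Qfun_nonneg (q : ℝ → ℝ) (x : ℝ) : 0 ≤ Qfun q x :=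
  setIntegral_nonneg measurableSet_Ioi fun _ _ => abs_nonneg _

lemma continuous_Qfun (hq : ∀ a, IntegrableOn (fun t => |q t|) (Ioi a)) :
    Continuous (Qfun q) :=
  (continuous_integral_Ioi hq).comp (continuous_id.div_const 2)

lemma antitone_Qfun (hq : ∀ a, IntegrableOn (fun t => |q t|) (Ioi a)) : Antitone (Qfun q) :=
  fun x y hxy => antitone_integral_Ioi hq (fun _ => abs_nonneg _)
    (show x / 2 ≤ y / 2 by linarith)

lemma integrableOn_Qfun (hq : Continuous q)
    (hmom : ∀ a : ℝ, IntegrableOn (fun t => (1 + t ^ 2) * |q t|) (Ioi a)) (a : ℝ) :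
    IntegrableOn (Qfun q) (Ioi a) := by
  have hint := integrableOn_abs_of_moment hq hmom
  have hcont := continuous_Qfun hint
  have h0 : IntegrableOn (Qfun q) (Ioi 0) := by
    set M := ∫ t in Ioi (0 : ℝ), (1 + t ^ 2) * |q t|
    have hmaj : Integrable fun u : ℝ => M * (1 + (u / 2) ^ 2)⁻¹ :=
      (integrable_inv_one_add_sq.comp_div two_ne_zero).const_mul M
    refine hmaj.integrableOn.mono' hcont.aestronglyMeasurable ?_
    filter_upwards [ae_restrict_mem measurableSet_Ioi] with u hu
    have hu0 : 0 ≤ u / 2 := (half_pos hu).le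
    rw [Real.norm_of_nonneg (Qfun_nonneg q u), ← div_eq_mul_inv, le_div_iff₀ (by positivity)]
    calc Qfun q u * (1 + (u / 2) ^ 2)
        = ∫ t in Ioi (u / 2), |q t| * (1 + (u / 2) ^ 2) := by
          rw [Qfun, MeasureTheory.integral_mul_const]
      _ ≤ ∫ t in Ioi (u / 2), (1 + t ^ 2) * |q t| := by
          refine setIntegral_mono_on ((hint _).mul_const _) (hmom _) measurableSet_Ioi fun t ht => ?_
          rw [mul_comm]
          have : (u / 2) ^ 2 ≤ t ^ 2 := pow_le_pow_left₀ hu0 (le_of_lt ht) 2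
          gcongr
      _ ≤ M := antitone_integral_Ioi hmom (fun t => by positivity) hu0
  refine (hcont.integrableOn_Icc (a := a) (b := 0)).union h0 |>.mono_set fun t ht => ?_
  rcases le_or_gt t 0 with h | h
  · exact Or.inl ⟨le_of_lt ht, h⟩
  · exact Or.inr h

lemma integrableOn_comp_half (hq : ∀ a, IntegrableOn (fun t => |q t|) (Ioi a)) (a : ℝ) :
    IntegrableOn (fun u => |q (u / 2)|) (Ioi a) := by
  have := (integrableOn_Ioi_comp_mul_right_iff (fun t => |q t|) a (a := (1 / 2 : ℝ))
    (by norm_num)).2 (hq _)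
  refine this.congr_fun (fun u _ => ?_) measurableSet_Ioi
  simp only [mul_one_div]

lemma integral_Ioi_comp_half (q : ℝ → ℝ) (a : ℝ) :
    ∫ u in Ioi a, |q (u / 2)| = 2 * Qfun q a := by
  have := integral_comp_mul_right_Ioi (fun t => |q t|) a (b := (1 / 2 : ℝ)) (by norm_num)
  simp only [one_div, inv_inv, smul_eq_mul] at this
  exact this

/-- The function `u ↦ |q (u / 2)| + Q u` that governs the first-order derivatives. -/
noncomputable def derivMajorant (q : ℝ → ℝ) (u : ℝ) : ℝ := |q (u / 2)| + Qfun q u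

/-- The integral of `derivMajorant q` over `(2x, ∞)`. -/
noncomputable def majorantTail (q : ℝ → ℝ) (x : ℝ) : ℝ := ∫ u in Ioi (2 * x), derivMajorant q u

lemma derivMajorant_nonneg (q : ℝ → ℝ) (u : ℝ) : 0 ≤ derivMajorant q u :=
  add_nonneg (abs_nonneg _) (Qfun_nonneg q u)

lemma Qfun_le_derivMajorant (q : ℝ → ℝ) (u : ℝ) : Qfun q u ≤ derivMajorant q u :=
  le_add_of_nonneg_left (abs_nonneg _)

lemma majorantTail_nonneg (q : ℝ → ℝ) (x : ℝ) : 0 ≤ majorantTail q x :=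
  setIntegral_nonneg measurableSet_Ioi fun _ _ => derivMajorant_nonneg q _

lemma continuous_derivMajorant (hq : Continuous q)
    (hmom : ∀ a : ℝ, IntegrableOn (fun t => (1 + t ^ 2) * |q t|) (Ioi a)) :
    Continuous (derivMajorant q) :=
  (hq.comp (continuous_id.div_const 2)).abs.add
    (continuous_Qfun (integrableOn_abs_of_moment hq hmom))

lemma integrableOn_derivMajorant (hq : Continuous q)
    (hmom : ∀ a : ℝ, IntegrableOn (fun t => (1 + t ^ 2) * |q t|) (Ioi a))
    (a : ℝ) : IntegrableOn (derivMajorant q) (Ioi a) :=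
  (integrableOn_comp_half (integrableOn_abs_of_moment hq hmom) a).add
    (integrableOn_Qfun hq hmom a)

lemma continuous_majorantTail (hq : Continuous q)
    (hmom : ∀ a : ℝ, IntegrableOn (fun t => (1 + t ^ 2) * |q t|) (Ioi a)) :
    Continuous (majorantTail q) :=
  (continuous_integral_Ioi (integrableOn_derivMajorant hq hmom)).comp (continuous_const_mul 2)

lemma antitone_majorantTail (hq : Continuous q)
    (hmom : ∀ a : ℝ, IntegrableOn (fun t => (1 + t ^ 2) * |q t|) (Ioi a)) :
    Antitone (majorantTail q) := fun x y hxy =>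
  antitone_integral_Ioi (integrableOn_derivMajorant hq hmom) (derivMajorant_nonneg q)
    (show 2 * x ≤ 2 * y by linarith)

lemma Qfun_two_mul_le_majorantTail (hq : Continuous q)
    (hmom : ∀ a : ℝ, IntegrableOn (fun t => (1 + t ^ 2) * |q t|) (Ioi a))
    (x : ℝ) : Qfun q (2 * x) ≤ majorantTail q x := by
  have hint := integrableOn_comp_half (integrableOn_abs_of_moment hq hmom) (2 * x)
  have h : ∫ u in Ioi (2 * x), |q (u / 2)| ≤ majorantTail q x :=
    setIntegral_mono_on hint (integrableOn_derivMajorant hq hmom _) measurableSet_Ioi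
      fun u _ => le_add_of_nonneg_right (Qfun_nonneg q u)
  rw [integral_Ioi_comp_half] at h
  linarith [Qfun_nonneg q (2 * x)]

lemma intervalIntegral_comp_half_le (hq : Continuous q)
    (hmom : ∀ a : ℝ, IntegrableOn (fun t => (1 + t ^ 2) * |q t|) (Ioi a))
    {a b : ℝ} (hab : a ≤ b) (c : ℝ) :
    ∫ t in a..b, |q ((c + t) / 2)| ≤ 2 * Qfun q (a + c) := by
  have hint := integrableOn_comp_half (integrableOn_abs_of_moment hq hmom)
  refine (intervalIntegral_le_integral_Ioi (integrableOn_Ioi_comp_add hint c)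
    (fun _ => abs_nonneg _) hab).trans_eq ?_
  rw [integral_Ioi_comp_add (fun u => |q (u / 2)|), integral_Ioi_comp_half, add_comm]

lemma intervalIntegral_derivMajorant_le (hq : Continuous q)
    (hmom : ∀ a : ℝ, IntegrableOn (fun t => (1 + t ^ 2) * |q t|) (Ioi a))
    {x c a b : ℝ} (hab : a ≤ b) (hx : 2 * x ≤ c + a) :
    ∫ t in a..b, derivMajorant q (c + t) ≤ majorantTail q x := by
  have hint := integrableOn_derivMajorant hq hmom
  refine (intervalIntegral_le_integral_Ioi (integrableOn_Ioi_comp_add hint c)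
    (fun _ => derivMajorant_nonneg q _) hab).trans ?_
  rw [integral_Ioi_comp_add]
  exact antitone_integral_Ioi hint (derivMajorant_nonneg q) hx

end Majorant

/-- The hypotheses relating the potential `q`, the transformation kernel `K` with its partial
derivatives `K₁`, `K₂`, and the symmetric GLM kernel `F`. -/
structure IsGLMPair (q : ℝ → ℝ) (K K₁ K₂ : ℝ → ℝ → ℝ) (C : ℝ → ℝ) (F : ℝ → ℝ → ℝ)
    (C₁ : ℝ → ℝ) : Prop where
  continuous_potential : Continuous q
  moment : ∀ a : ℝ, IntegrableOn (fun t => (1 + t ^ 2) * |q t|) (Ioi a)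
  hasDeriv_kernel : ∀ x y : ℝ, x ≤ y →
    HasDerivWithinAt (fun x' => K x' y) (K₁ x y) (Iic y) x ∧
    HasDerivWithinAt (fun y' => K x y') (K₂ x y) (Ici x) y
  pos : ∀ x, 0 < C x
  anti : Antitone C
  kernel_bound : ∀ x y : ℝ, x ≤ y → |K x y| ≤ C x * Qfun q (x + y)
  kernel_deriv_bound : ∀ x y : ℝ, x ≤ y →
    |K₁ x y| + |K₂ x y| ≤ C x * derivMajorant q (x + y)
  contDiff : ContDiff ℝ 1 fun p : ℝ × ℝ => F p.1 p.2
  symm : ∀ x y : ℝ, F x y = F y x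
  pos₁ : ∀ x, 0 < C₁ x
  anti₁ : Antitone C₁
  bound : ∀ x y : ℝ, x ≤ y → |F x y| ≤ C₁ x * Qfun q (x + y)
  glm : ∀ x y : ℝ, x ≤ y → K x y + F x y + ∫ t in Ioi x, K x t * F t y = 0

namespace IsGLMPair

variable {q : ℝ → ℝ} {K K₁ K₂ : ℝ → ℝ → ℝ} {C : ℝ → ℝ} {F : ℝ → ℝ → ℝ} {C₁ : ℝ → ℝ}

lemma integrableOn_potential (h : IsGLMPair q K K₁ K₂ C F C₁) (a : ℝ) :
    IntegrableOn (fun t => |q t|) (Ioi a) :=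
  integrableOn_abs_of_moment h.continuous_potential h.moment a

lemma hasDerivAt_fst (h : IsGLMPair q K K₁ K₂ C F C₁) (x y : ℝ) :
    HasDerivAt (fun x' => F x' y) (deriv (fun x' => F x' y) x) x := by
  have : Differentiable ℝ fun x' => F x' y :=
    (h.contDiff.differentiable one_ne_zero).comp (differentiable_id.prodMk
      (differentiable_const y))
  exact (this x).hasDerivAt

lemma hasDerivAt_snd (h : IsGLMPair q K K₁ K₂ C F C₁) (x y : ℝ) :
    HasDerivAt (fun y' => F x y') (deriv (fun x' => F x' x) y) y := by
  simpa only [h.symm x] using h.hasDerivAt_fst y x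

lemma continuous_deriv (h : IsGLMPair q K K₁ K₂ C F C₁) :
    Continuous fun p : ℝ × ℝ => deriv (fun x' => F x' p.2) p.1 := by
  have hd : Differentiable ℝ fun p : ℝ × ℝ => F p.1 p.2 := h.contDiff.differentiable one_ne_zero
  have heq : (fun p : ℝ × ℝ => deriv (fun x' => F x' p.2) p.1)
      = fun p => fderiv ℝ (fun p : ℝ × ℝ => F p.1 p.2) p (1, 0) := by
    funext p
    exact ((hd p).hasFDerivAt.comp_hasDerivAt p.1
      ((hasDerivAt_id p.1).prodMk (hasDerivAt_const p.1 p.2))).deriv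
  rw [heq]
  exact (h.contDiff.continuous_fderiv one_ne_zero).clm_apply continuous_const

lemma continuousOn_kernel_snd (h : IsGLMPair q K K₁ K₂ C F C₁) (x : ℝ) :
    ContinuousOn (K x) (Ici x) := fun y hy =>
  (h.hasDeriv_kernel x y hy).2.continuousWithinAt

lemma abs_le (h : IsGLMPair q K K₁ K₂ C F C₁) {x y t : ℝ} (ht : x ≤ t) (hy : x ≤ y) :
    |F t y| ≤ C₁ x * Qfun q (x + y) := by
  have hanti := antitone_Qfun h.integrableOn_potential
  have hmul : ∀ {z u : ℝ}, x ≤ z → x + y ≤ u → C₁ z * Qfun q u ≤ C₁ x * Qfun q (x + y) :=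
    fun hz hu => mul_le_mul (h.anti₁ hz) (hanti hu) (Qfun_nonneg q _) (h.pos₁ x).le
  rcases le_total t y with hty | hty
  · exact (h.bound t y hty).trans (hmul ht (by linarith))
  · rw [h.symm]
    exact (h.bound y t hty).trans (hmul hy (by linarith))

lemma kernel_abs_le (h : IsGLMPair q K K₁ K₂ C F C₁) {x y t : ℝ} (hy : x ≤ y) (ht : y ≤ t) :
    |K x t| ≤ C x * Qfun q (x + y) :=
  (h.kernel_bound x t (hy.trans ht)).trans
    (mul_le_mul_of_nonneg_left (antitone_Qfun h.integrableOn_potential (by linarith))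
      (h.pos x).le)

lemma integrableOn_kernel (h : IsGLMPair q K K₁ K₂ C F C₁) (x : ℝ) :
    IntegrableOn (K x) (Ioi x) := by
  have hint := integrableOn_Ioi_comp_add
    (integrableOn_Qfun h.continuous_potential h.moment) x x
  refine (hint.const_mul (C x)).mono'
    (((h.continuousOn_kernel_snd x).mono Ioi_subset_Ici_self).aestronglyMeasurable
      measurableSet_Ioi) ?_
  filter_upwards [ae_restrict_mem measurableSet_Ioi] with t ht
  exact h.kernel_bound x t (le_of_lt ht)

lemma integrableOn_kernel_mul (h : IsGLMPair q K K₁ K₂ C F C₁) {x y : ℝ} (hxy : x ≤ y) :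
    IntegrableOn (fun t => K x t * F t y) (Ioi x) := by
  have hF : Continuous fun t => F t y :=
    h.contDiff.continuous.comp (continuous_id.prodMk continuous_const)
  refine ((h.integrableOn_kernel x).norm.mul_const (C₁ x * Qfun q (x + y))).mono'
    ((h.integrableOn_kernel x).aestronglyMeasurable.mul hF.aestronglyMeasurable) ?_
  filter_upwards [ae_restrict_mem measurableSet_Ioi] with t ht
  rw [norm_mul]
  exact mul_le_mul_of_nonneg_left (h.abs_le (le_of_lt ht) hxy) (norm_nonneg _)

lemma kernel_abs_sub_le (h : IsGLMPair q K K₁ K₂ C F C₁) {x x' t : ℝ} (hx : x ≤ x')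
    (ht : x' ≤ t) :
    |K x' t - K x t| ≤ C x * ∫ s in x..x', derivMajorant q (s + t) := by
  have hc := continuous_derivMajorant h.continuous_potential h.moment
  rw [← intervalIntegral.integral_const_mul]
  refine abs_sub_le_integral_of_hasDerivAt (f := fun s => K s t) (f' := fun s => K₁ s t) hx
    (fun s hs => ?_) (fun s hs => ?_) (by fun_prop) (fun s hs => ?_)
  · exact (h.hasDeriv_kernel s t (hs.2.trans ht)).1.continuousWithinAt.mono
      fun u hu => hu.2.trans ht
  · have hst : s < t := hs.2.trans_le ht
    exact (h.hasDeriv_kernel s t hst.le).1.hasDerivAt (Iic_mem_nhds hst)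
  · have := h.kernel_deriv_bound s t (hs.2.le.trans ht)
    have h2 := mul_le_mul_of_nonneg_right (h.anti hs.1.le) (derivMajorant_nonneg q (s + t))
    linarith [abs_nonneg (K₂ s t)]

lemma abs_sub_fst_le (h : IsGLMPair q K K₁ K₂ C F C₁) {x x' y : ℝ} (hx : x ≤ x')
    (hy : x' ≤ y) :
    |(F x' y + K x' y) - (F x y + K x y)| ≤
      (x' - x) * (2 * C x * C₁ x * majorantTail q x * Qfun q (x + y)) := by
  have hxy := hx.trans hy
  have hanti := antitone_Qfun h.integrableOn_potential
  set B := C₁ x * Qfun q (x + y) with hB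
  have hB0 : 0 ≤ B := mul_nonneg (h.pos₁ x).le (Qfun_nonneg q _)
  have hI := h.integrableOn_kernel_mul hxy
  have hI' := h.integrableOn_kernel_mul hy
  have hIx' := hI.mono_set (Ioi_subset_Ioi hx)
  have hsplit := integral_interval_add_Ioi hI hIx'
  have hsub : (F x' y + K x' y) - (F x y + K x y) = (∫ t in x..x', K x t * F t y) +
      ∫ t in Ioi x', (K x t * F t y - K x' t * F t y) := by
    rw [MeasureTheory.integral_sub hIx' hI']
    linarith [h.glm x y hxy, h.glm x' y hy]
  have hnear : |∫ t in x..x', K x t * F t y| ≤ C x * majorantTail q x * B * (x' - x) := by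
    have := norm_integral_le_of_norm_le_const (a := x) (b := x')
      (f := fun t => K x t * F t y) (C := C x * majorantTail q x * B) (fun t ht => by
        rw [uIoc_of_le hx] at ht
        rw [norm_mul]
        refine mul_le_mul ?_ (h.abs_le ht.1.le hxy) (norm_nonneg _)
          (mul_nonneg (h.pos x).le (majorantTail_nonneg q x))
        refine (h.kernel_abs_le le_rfl ht.1.le).trans
          (mul_le_mul_of_nonneg_left ?_ (h.pos x).le)
        rw [← two_mul]
        exact Qfun_two_mul_le_majorantTail h.continuous_potential h.moment x)
    rwa [abs_of_nonneg (sub_nonneg.2 hx)] at this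
  obtain ⟨hti, htb⟩ := integral_Ioi_intervalIntegral_comp_add_le
    (continuous_derivMajorant h.continuous_potential h.moment)
    (integrableOn_derivMajorant h.continuous_potential h.moment) (derivMajorant_nonneg q) hx x'
  have hfar : |∫ t in Ioi x', (K x t * F t y - K x' t * F t y)| ≤
      (x' - x) * majorantTail q x * (C x * B) := by
    have := MeasureTheory.norm_integral_le_of_norm_le (μ := volume.restrict (Ioi x'))
      (f := fun t => K x t * F t y - K x' t * F t y)
      (hti.mul_const (C x * B)) (by
        filter_upwards [ae_restrict_mem measurableSet_Ioi] with t ht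
        have ht' : x' ≤ t := le_of_lt ht
        rw [← sub_mul, norm_mul, norm_sub_rev]
        refine (mul_le_mul (h.kernel_abs_sub_le hx ht') (h.abs_le (hx.trans ht') hxy)
          (abs_nonneg _) ((abs_nonneg _).trans (h.kernel_abs_sub_le hx ht'))).trans_eq ?_
        ring)
    rw [MeasureTheory.integral_mul_const] at this
    refine this.trans (mul_le_mul_of_nonneg_right (htb.trans ?_) (mul_nonneg (h.pos x).le hB0))
    refine mul_le_mul_of_nonneg_left ?_ (sub_nonneg.2 hx)
    exact antitone_integral_Ioi (integrableOn_derivMajorant h.continuous_potential h.moment)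
      (derivMajorant_nonneg q) (by linarith)
  rw [hsub]
  refine (abs_add_le _ _).trans ((add_le_add hnear hfar).trans_eq ?_)
  rw [hB]
  ring

lemma abs_deriv_fst_le (h : IsGLMPair q K K₁ K₂ C F C₁) {x y : ℝ} (hxy : x ≤ y) :
    |deriv (fun x' => F x' y) x| ≤
      C x * (1 + 2 * C₁ x * majorantTail q x) * derivMajorant q (x + y) := by
  have hlt : ∀ y, x < y → |deriv (fun x' => F x' y) x| ≤
      C x * (1 + 2 * C₁ x * majorantTail q x) * derivMajorant q (x + y) := by
    intro y hxy
    have hd := ((h.hasDerivAt_fst x y).add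
      ((h.hasDeriv_kernel x y hxy.le).1.hasDerivAt (Iic_mem_nhds hxy))).hasDerivWithinAt
      (s := Ici x)
    have h1 := hd.abs_le_of_forall_abs_sub_le hxy fun x' hx' => h.abs_sub_fst_le hx'.1.le hx'.2.le
    have h2 := h.kernel_deriv_bound x y hxy.le
    have h3 := abs_sub_abs_le_abs_sub (deriv (fun x' => F x' y) x) (-K₁ x y)
    rw [abs_neg, sub_neg_eq_add] at h3
    have h4 : 2 * C x * C₁ x * majorantTail q x * Qfun q (x + y) ≤
        2 * C x * C₁ x * majorantTail q x * derivMajorant q (x + y) :=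
      mul_le_mul_of_nonneg_left (Qfun_le_derivMajorant q _) (mul_nonneg
        (mul_nonneg (mul_nonneg two_pos.le (h.pos x).le) (h.pos₁ x).le) (majorantTail_nonneg q x))
    have h5 := abs_nonneg (K₂ x y)
    linarith
  have hc := continuous_derivMajorant h.continuous_potential h.moment
  have hleft : Continuous fun y => |deriv (fun x' => F x' y) x| :=
    (h.continuous_deriv.comp (continuous_const.prodMk continuous_id)).abs
  refine ContinuousWithinAt.closure_le (s := Ioi x) (by simpa using hxy)
    hleft.continuousWithinAt (Continuous.continuousWithinAt (by fun_prop)) fun y hy => hlt y hy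

lemma abs_sub_le_of_deriv_bound (h : IsGLMPair q K K₁ K₂ C F C₁) {D : ℝ → ℝ}
    (hD : Antitone D) (hder : ∀ x y, x ≤ y →
      |deriv (fun x' => F x' y) x| ≤ D x * derivMajorant q (x + y))
    {y y' t : ℝ} (hy : y ≤ y') (ht : y' ≤ t) :
    |F t y' - F t y| ≤ D y * ∫ s in y..y', derivMajorant q (s + t) := by
  have hc := continuous_derivMajorant h.continuous_potential h.moment
  rw [← intervalIntegral.integral_const_mul, h.symm t y', h.symm t y]
  refine abs_sub_le_integral_of_hasDerivAt (f := fun s => F s t) hy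
    (fun s _ => (h.hasDerivAt_fst s t).continuousAt.continuousWithinAt)
    (fun s _ => h.hasDerivAt_fst s t) (by fun_prop) (fun s hs => ?_)
  exact (hder s t (hs.2.le.trans ht)).trans
    (mul_le_mul_of_nonneg_right (hD hs.1.le) (derivMajorant_nonneg q _))

lemma hasDerivAt_integral (h : IsGLMPair q K K₁ K₂ C F C₁) {x b : ℝ} (hb : x ≤ b) (y : ℝ) :
    HasDerivAt (fun y' => ∫ t in x..b, K x t * F t y')
      (∫ t in x..b, K x t * deriv (fun x' => F x' t) y) y := by
  have hK : ContinuousOn (K x) (Icc x b) := (h.continuousOn_kernel_snd x).mono Icc_subset_Ici_self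
  have hF : ∀ y', Continuous fun t => F t y' := fun y' =>
    h.contDiff.continuous.comp (continuous_id.prodMk continuous_const)
  have hF' : ∀ y', Continuous fun t => deriv (fun x' => F x' t) y' := fun y' =>
    h.continuous_deriv.comp (continuous_const.prodMk continuous_id)
  have hsub : uIoc x b ⊆ Icc x b := by
    rw [uIoc_of_le hb]
    exact Ioc_subset_Icc_self
  obtain ⟨M, hM⟩ := ((isCompact_closedBall y 1).prod isCompact_Icc).exists_bound_of_continuousOn
    (f := fun p : ℝ × ℝ => K x p.2 * deriv (fun x' => F x' p.2) p.1)
    ((hK.comp continuousOn_snd fun p hp => hp.2).mul h.continuous_deriv.continuousOn)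
  refine (intervalIntegral.hasDerivAt_integral_of_dominated_loc_of_deriv_le (bound := fun _ => M)
    (F := fun y' t => K x t * F t y') (F' := fun y' t => K x t * deriv (fun x' => F x' t) y')
    (Metric.closedBall_mem_nhds y one_pos) (Eventually.of_forall fun y' => ?_) ?_ ?_ ?_ ?_ ?_).2
  · exact ((hK.mul (hF y').continuousOn).mono hsub).aestronglyMeasurable measurableSet_uIoc
  · exact (hK.mul (hF y).continuousOn).intervalIntegrable_of_Icc hb
  · exact ((hK.mul (hF' y).continuousOn).mono hsub).aestronglyMeasurable measurableSet_uIoc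
  · exact Eventually.of_forall fun t ht y' hy' => hM (y', t) ⟨hy', hsub ht⟩
  · exact intervalIntegrable_const
  · exact Eventually.of_forall fun t _ y' _ => (h.hasDerivAt_snd t y').const_mul (K x t)

lemma abs_sub_snd_le (h : IsGLMPair q K K₁ K₂ C F C₁) {D : ℝ → ℝ} (hD0 : ∀ x, 0 ≤ D x)
    (hD : Antitone D) (hder : ∀ x y, x ≤ y →
      |deriv (fun x' => F x' y) x| ≤ D x * derivMajorant q (x + y))
    {x y y' b : ℝ} (hxy : x ≤ y) (hy : y ≤ y') (hb : y' ≤ b) :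
    |(F x y' + K x y' + ∫ t in x..b, K x t * F t y') -
        (F x y + K x y + ∫ t in x..b, K x t * F t y)| ≤
      (y' - y) * (C x * Qfun q (x + y) * D x * majorantTail q x) := by
  have hxy' := hxy.trans hy
  have hxb := hxy'.trans hb
  have hI := h.integrableOn_kernel_mul hxy
  have hI' := h.integrableOn_kernel_mul hxy'
  have hIb := hI.mono_set (Ioi_subset_Ioi hxb)
  have hIb' := hI'.mono_set (Ioi_subset_Ioi hxb)
  have hsplit := integral_interval_add_Ioi hI hIb
  have hsplit' := integral_interval_add_Ioi hI' hIb'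
  have hA0 : 0 ≤ C x * Qfun q (x + y) := mul_nonneg (h.pos x).le (Qfun_nonneg q _)
  have hsub : (F x y' + K x y' + ∫ t in x..b, K x t * F t y') -
        (F x y + K x y + ∫ t in x..b, K x t * F t y) =
      ∫ t in Ioi b, (K x t * F t y - K x t * F t y') := by
    rw [MeasureTheory.integral_sub hIb hIb']
    linarith [h.glm x y hxy, h.glm x y' hxy']
  obtain ⟨hti, htb⟩ := integral_Ioi_intervalIntegral_comp_add_le
    (continuous_derivMajorant h.continuous_potential h.moment)
    (integrableOn_derivMajorant h.continuous_potential h.moment) (derivMajorant_nonneg q) hy b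
  have hfar := MeasureTheory.norm_integral_le_of_norm_le (μ := volume.restrict (Ioi b))
    (f := fun t => K x t * F t y - K x t * F t y')
    (hti.mul_const (C x * Qfun q (x + y) * D x)) (by
      filter_upwards [ae_restrict_mem measurableSet_Ioi] with t ht
      have hbt : b ≤ t := le_of_lt ht
      have hF := h.abs_sub_le_of_deriv_bound hD hder hy (hb.trans hbt)
      have hg : 0 ≤ ∫ s in y..y', derivMajorant q (s + t) :=
        integral_nonneg hy fun _ _ => derivMajorant_nonneg q _
      rw [← mul_sub, norm_mul, norm_sub_rev]
      refine (mul_le_mul (h.kernel_abs_le hxy (hy.trans (hb.trans hbt)))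
        (hF.trans (mul_le_mul_of_nonneg_right (hD hxy) hg)) (abs_nonneg _) hA0).trans_eq ?_
      ring)
  rw [MeasureTheory.integral_mul_const] at hfar
  rw [hsub]
  refine hfar.trans ((mul_le_mul_of_nonneg_right (htb.trans
    (mul_le_mul_of_nonneg_left ?_ (sub_nonneg.2 hy))) (mul_nonneg hA0 (hD0 x))).trans_eq
      (by ring : (y' - y) * majorantTail q x * (C x * Qfun q (x + y) * D x) = _))
  exact antitone_integral_Ioi (integrableOn_derivMajorant h.continuous_potential h.moment)
    (derivMajorant_nonneg q) (by linarith)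

/-- Volterra-type inequality for `∂F/∂y`, written through the symmetry of `F`. -/
lemma abs_deriv_snd_le_add_integral (h : IsGLMPair q K K₁ K₂ C F C₁) {D : ℝ → ℝ}
    (hD0 : ∀ x, 0 ≤ D x) (hD : Antitone D) (hder : ∀ x y, x ≤ y →
      |deriv (fun x' => F x' y) x| ≤ D x * derivMajorant q (x + y))
    {x y : ℝ} (hxy : x ≤ y) :
    |deriv (fun x' => F x' x) y| ≤ C x * |q ((x + y) / 2)| +
      C x * (1 + 2 * D x * majorantTail q x) * Qfun q (x + y) +
      ∫ t in x..y, C x * Qfun q (x + t) * |deriv (fun x' => F x' t) y| := by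
  have hyb : y ≤ y + 1 := by linarith
  have hxb : x ≤ y + 1 := by linarith
  have hQc := continuous_Qfun h.integrableOn_potential
  have hgc := continuous_derivMajorant h.continuous_potential h.moment
  have hφc : Continuous fun t => deriv (fun x' => F x' t) y :=
    h.continuous_deriv.comp (continuous_const.prodMk continuous_id)
  have hA0 : 0 ≤ C x * Qfun q (x + y) := mul_nonneg (h.pos x).le (Qfun_nonneg q _)
  have hd := ((h.hasDerivAt_snd x y).hasDerivWithinAt (s := Ici y)).add
    ((h.hasDeriv_kernel x y hxy).2.mono (Ici_subset_Ici.2 hxy)) |>.add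
    (h.hasDerivAt_integral hxb y).hasDerivWithinAt
  have h1 := hd.abs_le_of_forall_abs_sub_le (by linarith : y < y + 1) fun y' hy' =>
    h.abs_sub_snd_le hD0 hD hder hxy hy'.1.le hy'.2.le
  have h2 := h.kernel_deriv_bound x y hxy
  have hic : Continuous fun t => C x * Qfun q (x + t) * |deriv (fun x' => F x' t) y| := by
    fun_prop
  have hKint : |∫ t in x..y + 1, K x t * deriv (fun x' => F x' t) y| ≤
      ∫ t in x..y + 1, C x * Qfun q (x + t) * |deriv (fun x' => F x' t) y| := by
    refine intervalIntegral.norm_integral_le_of_norm_le (μ := volume)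
      (f := fun t => K x t * deriv (fun x' => F x' t) y) hxb (Eventually.of_forall fun t ht => ?_)
      (hic.intervalIntegrable _ _)
    rw [norm_mul]
    exact mul_le_mul_of_nonneg_right (h.kernel_bound x t ht.1.le) (norm_nonneg _)
  have hsplit := integral_add_adjacent_intervals (hic.intervalIntegrable (μ := volume) x y)
    (hic.intervalIntegrable y (y + 1))
  have htail : ∫ t in y..y + 1, C x * Qfun q (x + t) * |deriv (fun x' => F x' t) y| ≤
      C x * Qfun q (x + y) * D x * majorantTail q x := by
    calc ∫ t in y..y + 1, C x * Qfun q (x + t) * |deriv (fun x' => F x' t) y|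
        ≤ ∫ t in y..y + 1, C x * Qfun q (x + y) * D x * derivMajorant q (y + t) := by
          refine integral_mono_on hyb (hic.intervalIntegrable _ _)
            (Continuous.intervalIntegrable (by fun_prop) _ _) fun t ht => ?_
          rw [mul_assoc (C x * Qfun q (x + y))]
          refine mul_le_mul (mul_le_mul_of_nonneg_left
            (antitone_Qfun h.integrableOn_potential (by linarith [ht.1])) (h.pos x).le)
            ((hder y t ht.1).trans (mul_le_mul_of_nonneg_right (hD hxy)
              (derivMajorant_nonneg q _))) (abs_nonneg _) hA0
      _ ≤ C x * Qfun q (x + y) * D x * majorantTail q x := by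
          rw [intervalIntegral.integral_const_mul]
          exact mul_le_mul_of_nonneg_left (intervalIntegral_derivMajorant_le
            h.continuous_potential h.moment hyb (by linarith)) (mul_nonneg hA0 (hD0 x))
  have h3 : ∀ a b c : ℝ, |a| ≤ |a + b + c| + |b| + |c| := fun a b c => by
    have := abs_sub_abs_le_abs_sub a (-b - c)
    have := abs_sub (-b) c
    grind
  have h3 := h3 (deriv (fun x' => F x' x) y) (K₂ x y)
    (∫ t in x..y + 1, K x t * deriv (fun x' => F x' t) y)
  have h4 := abs_nonneg (K₁ x y)
  unfold derivMajorant at h2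
  linarith

end IsGLMPair

lemma IsGLMPair.abs_deriv_snd_le {q : ℝ → ℝ} {K K₁ K₂ : ℝ → ℝ → ℝ} {C : ℝ → ℝ}
    {F : ℝ → ℝ → ℝ} {C₁ : ℝ → ℝ} (h : IsGLMPair q K K₁ K₂ C F C₁) {D : ℝ → ℝ}
    (hD0 : ∀ x, 0 ≤ D x) (hD : Antitone D) (hder : ∀ x y, x ≤ y →
      |deriv (fun x' => F x' y) x| ≤ D x * derivMajorant q (x + y))
    {x y : ℝ} (hxy : x ≤ y) :
    |deriv (fun x' => F x' x) y| ≤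
      (C x * (1 + 2 * D x * majorantTail q x) + Real.exp (C x * majorantTail q x) *
        (C x ^ 2 * majorantTail q x * (3 + 2 * D x * majorantTail q x))) *
        derivMajorant q (x + y) := by
  have hQc := continuous_Qfun h.integrableOn_potential
  have hanti := antitone_Qfun h.integrableOn_potential
  have hIanti := antitone_majorantTail h.continuous_potential h.moment
  have hqc := h.continuous_potential
  have hφc : Continuous fun t => deriv (fun x' => F x' t) y :=
    h.continuous_deriv.comp (continuous_const.prodMk continuous_id)
  set c := C x with hc
  set d := D x with hd
  set i := majorantTail q x with hi
  set Q := Qfun q (x + y) with hQ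
  have hc0 : 0 ≤ c := (h.pos x).le
  have hd0 : 0 ≤ d := hD0 x
  have hi0 : 0 ≤ i := majorantTail_nonneg q x
  have hQ0 : 0 ≤ Q := Qfun_nonneg q _
  have hkc : Continuous fun t => c * Qfun q (x + t) := by fun_prop
  have hk0 : ∀ t, 0 ≤ c * Qfun q (x + t) := fun t => mul_nonneg hc0 (Qfun_nonneg q _)
  have hgron := gronwall_backward (φ := fun t => |deriv (fun x' => F x' t) y|)
    (k := fun t => c * Qfun q (x + t))
    (α := fun t => c * |q ((y + t) / 2)| + c * (1 + 2 * d * i) * Q)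
    hφc.abs hkc (by fun_prop) hk0 (fun t => by positivity) hxy (by
      intro z hz
      have hz1 := h.abs_deriv_snd_le_add_integral hD0 hD hder hz.2
      have hCz : C z ≤ c := h.anti hz.1
      have hDz : D z ≤ d := hD hz.1
      have hIz : majorantTail q z ≤ i := hIanti hz.1
      have hQz : Qfun q (z + y) ≤ Q := hanti (by linarith [hz.1])
      have hCz0 := (h.pos z).le
      have hDz0 := hD0 z
      have hIz0 := majorantTail_nonneg q z
      have hQz0 := Qfun_nonneg q (z + y)
      have h1 : C z * |q ((z + y) / 2)| ≤ c * |q ((y + z) / 2)| := by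
        rw [add_comm z y]
        gcongr
      have h2 : C z * (1 + 2 * D z * majorantTail q z) * Qfun q (z + y) ≤
          c * (1 + 2 * d * i) * Q := by gcongr
      have h3 : ∫ t in z..y, C z * Qfun q (z + t) * |deriv (fun x' => F x' t) y| ≤
          ∫ t in z..y, c * Qfun q (x + t) * |deriv (fun x' => F x' t) y| := by
        refine integral_mono_on hz.2 (Continuous.intervalIntegrable (by fun_prop) _ _)
          (Continuous.intervalIntegrable (by fun_prop) _ _) fun t _ => ?_
        have : Qfun q (z + t) ≤ Qfun q (x + t) := hanti (by linarith [hz.1])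
        have := Qfun_nonneg q (z + t)
        gcongr
      linarith)
  have hkint : ∫ t in x..y, c * Qfun q (x + t) ≤ c * i := by
    rw [intervalIntegral.integral_const_mul]
    refine mul_le_mul_of_nonneg_left (le_trans ?_ (intervalIntegral_derivMajorant_le hqc h.moment
      hxy (by linarith : 2 * x ≤ x + x))) hc0
    have hgc := continuous_derivMajorant hqc h.moment
    exact integral_mono_on hxy (Continuous.intervalIntegrable (by fun_prop) _ _)
      (Continuous.intervalIntegrable (by fun_prop) _ _) fun t _ => Qfun_le_derivMajorant q _
  have hkα : ∫ t in x..y, c * Qfun q (x + t) * (c * |q ((y + t) / 2)| + c * (1 + 2 * d * i) * Q) ≤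
      c ^ 2 * i * (3 + 2 * d * i) * Q := by
    calc ∫ t in x..y, c * Qfun q (x + t) * (c * |q ((y + t) / 2)| + c * (1 + 2 * d * i) * Q)
        ≤ ∫ t in x..y, (c ^ 2 * i * |q ((y + t) / 2)| +
            c * (1 + 2 * d * i) * Q * (c * Qfun q (x + t))) := by
          refine integral_mono_on hxy (Continuous.intervalIntegrable (by fun_prop) _ _)
            (Continuous.intervalIntegrable (by fun_prop) _ _) fun t ht => ?_
          have hQi : Qfun q (x + t) ≤ i :=
            (hanti (by linarith [ht.1])).trans (Qfun_two_mul_le_majorantTail hqc h.moment x)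
          have := mul_le_mul_of_nonneg_left hQi
            (by positivity : 0 ≤ c ^ 2 * |q ((y + t) / 2)|)
          linarith
      _ = c ^ 2 * i * (∫ t in x..y, |q ((y + t) / 2)|) +
            c * (1 + 2 * d * i) * Q * ∫ t in x..y, c * Qfun q (x + t) := by
          rw [intervalIntegral.integral_add (Continuous.intervalIntegrable (by fun_prop) _ _)
            (Continuous.intervalIntegrable (by fun_prop) _ _),
            intervalIntegral.integral_const_mul, intervalIntegral.integral_const_mul]
      _ ≤ c ^ 2 * i * (2 * Q) + c * (1 + 2 * d * i) * Q * (c * i) := by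
          gcongr
          exact intervalIntegral_comp_half_le hqc h.moment hxy y
      _ = c ^ 2 * i * (3 + 2 * d * i) * Q := by ring
  have hexp : Real.exp (∫ t in x..y, c * Qfun q (x + t)) *
      ∫ t in x..y, c * Qfun q (x + t) * (c * |q ((y + t) / 2)| + c * (1 + 2 * d * i) * Q) ≤
      Real.exp (c * i) * (c ^ 2 * i * (3 + 2 * d * i) * Q) :=
    mul_le_mul (Real.exp_le_exp.2 hkint) hkα
      (integral_nonneg hxy fun t _ => mul_nonneg (hk0 t) (by positivity)) (Real.exp_pos _).le
  simp only [add_comm y x] at hgron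
  have hq1 : 0 ≤ c * (2 * d * i) * |q ((x + y) / 2)| := by positivity
  have hq2 : 0 ≤ Real.exp (c * i) * (c ^ 2 * i * (3 + 2 * d * i)) * |q ((x + y) / 2)| := by
    positivity
  unfold derivMajorant
  rw [← hQ]
  linarith

/-- Estimate (A.30) of Lemma A.3: under the estimates on `K` and its first-order
partial derivatives, the GLM kernel `F` satisfies
`|∂F/∂x| + |∂F/∂y| ≤ Ĉ(x)·(|q((x+y)/2)| + Q(x+y))` on `{y ≥ x}`. -/
theorem glm_kernel_derivative_estimate
    (q : ℝ → ℝ) (hq : Continuous q)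
    (hmom : ∀ a : ℝ, IntegrableOn (fun t => (1 + t ^ 2) * |q t|) (Set.Ioi a))
    (K K₁ K₂ : ℝ → ℝ → ℝ)
    (hKcont : ContinuousOn (fun p : ℝ × ℝ => K p.1 p.2) {p : ℝ × ℝ | p.1 ≤ p.2})
    (hK₁cont : ContinuousOn (fun p : ℝ × ℝ => K₁ p.1 p.2) {p : ℝ × ℝ | p.1 ≤ p.2})
    (hK₂cont : ContinuousOn (fun p : ℝ × ℝ => K₂ p.1 p.2) {p : ℝ × ℝ | p.1 ≤ p.2})
    (hKder : ∀ x y : ℝ, x ≤ y →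
      HasDerivWithinAt (fun x' => K x' y) (K₁ x y) (Set.Iic y) x ∧
      HasDerivWithinAt (fun y' => K x y') (K₂ x y) (Set.Ici x) y)
    (C : ℝ → ℝ) (hC : Continuous C) (hCpos : ∀ x, 0 < C x) (hCanti : Antitone C)
    (hKbd : ∀ x y : ℝ, x ≤ y → |K x y| ≤ C x * Qfun q (x + y))
    (hKdbd : ∀ x y : ℝ, x ≤ y →
      |K₁ x y| + |K₂ x y| ≤ C x * (|q ((x + y) / 2)| + Qfun q (x + y)))
    (F : ℝ → ℝ → ℝ)
    (hFdiff : ContDiff ℝ 1 fun p : ℝ × ℝ => F p.1 p.2)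
    (hFsymm : ∀ x y : ℝ, F x y = F y x)
    (C₁ : ℝ → ℝ) (hC₁ : Continuous C₁) (hC₁pos : ∀ x, 0 < C₁ x) (hC₁anti : Antitone C₁)
    (hFbd : ∀ x y : ℝ, x ≤ y → |F x y| ≤ C₁ x * Qfun q (x + y))
    (hGLM : ∀ x y : ℝ, x ≤ y →
      K x y + F x y + ∫ t in Set.Ioi x, K x t * F t y = 0) :
    ∃ Chat : ℝ → ℝ, Continuous Chat ∧ (∀ x, 0 < Chat x) ∧ Antitone Chat ∧
      ∀ x y : ℝ, x ≤ y →
        |deriv (fun x' => F x' y) x| + |deriv (fun y' => F x y') y| ≤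
          Chat x * (|q ((x + y) / 2)| + Qfun q (x + y)) := by
  have h : IsGLMPair q K K₁ K₂ C F C₁ :=
    ⟨hq, hmom, hKder, hCpos, hCanti, hKbd, hKdbd, hFdiff, hFsymm, hC₁pos, hC₁anti,
      hFbd, hGLM⟩
  have hIc := continuous_majorantTail hq hmom
  have hIanti := antitone_majorantTail hq hmom
  have hI0 := majorantTail_nonneg q
  set I := majorantTail q
  set D : ℝ → ℝ := fun x => C x * (1 + 2 * C₁ x * I x) with hDdef
  have hDpos : ∀ x, 0 < D x := fun x =>
    mul_pos (hCpos x) (by have := mul_nonneg (hC₁pos x).le (hI0 x); linarith)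
  have hDanti : Antitone D := fun x y hxy => by
    have h1 := hCanti hxy
    have h2 := hC₁anti hxy
    have h3 := hIanti hxy
    have h4 := (hCpos x).le
    have h5 := (hC₁pos x).le
    have h6 := (hC₁pos y).le
    have h7 := hI0 y
    simp only [hDdef]
    gcongr
  have hDc : Continuous D := by fun_prop
  refine ⟨fun x => D x + (C x * (1 + 2 * D x * I x) + Real.exp (C x * I x) *
        (C x ^ 2 * I x * (3 + 2 * D x * I x))), by fun_prop, fun x => ?_, fun x y hxy => ?_,
        fun x y hxy => ?_⟩
  · have h1 := hDpos x
    have h2 := hCpos x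
    have h3 := hI0 x
    positivity
  · have h1 := hCanti hxy
    have h2 := hDanti hxy
    have h3 := hIanti hxy
    have h4 := (hCpos x).le
    have h5 := (hCpos y).le
    have h6 := (hDpos x).le
    have h7 := (hDpos y).le
    have h8 := hI0 x
    have h9 := hI0 y
    dsimp only
    gcongr
  · have h1 := h.abs_deriv_fst_le hxy
    have h2 := h.abs_deriv_snd_le (fun x => (hDpos x).le) hDanti
      (fun _ _ hxy => h.abs_deriv_fst_le hxy) hxy
    simp only [hFsymm x]
    rw [add_mul]
    exact add_le_add h1 h2
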